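/- An algebraic system (G,·,⋏,χ,δ), where (G,·) is a semigroup, (G,⋏) is a semilattice and χ, δ are binary relations on G (write x ⊏ y for (x,y) ∈ χ, x ⊢ y for (x,y) ∈ δ, and x ≤ y for x⋏y = x), is isomorphic to some projection ∩-semigroup (Φ,∘,∩,χ_Φ,δ_Φ) of transformations if and only if the following hold: χ is a left regular and right negative quasi-order containing the semilattice order ≤; x(y⋏z) = xy⋏xz; x ⊏ x⋏y implies x ≤ y; (x⋏y)u ≤ yu; x ⊏ y⋏z together with x ⊏ (z⋏v)u implies x ⊏ (y⋏z⋏v)u (the last two conditions also in the versions with the factor u omitted); and the equivalence x ⊢ y ⟺ x ⊏ xy holds for all x, y ∈ G. -/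

import Mathlib

universe u

/-- A transformation (partial map) of `A`, viewed as a binary relation. -/
def IsTransformation {A : Type*} (f : Set (A × A)) : Prop :=
  ∀ ⦃a b c : A⦄, (a, b) ∈ f → (a, c) ∈ f → b = c

/-- Composition of binary relations: `comp g f = g ∘ f`. -/
def comp {A : Type*} (g f : Set (A × A)) : Set (A × A) :=
  {p | ∃ b, (p.1, b) ∈ f ∧ (b, p.2) ∈ g}

/-- The domain of a binary relation. -/
def pr1 {A : Type*} (f : Set (A × A)) : Set A := {a | ∃ b, (a, b) ∈ f}

/-- The image of a binary relation. -/
def pr2 {A : Type*} (f : Set (A × A)) : Set A := {b | ∃ a, (a, b) ∈ f}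

/-- `act mul g x` is the product `g·x` where the factor `x` may be omitted
(`x = none` meaning the omitted factor). -/
def act {G : Type u} (mul : G → G → G) (g : G) : Option G → G
  | none => g
  | some h => mul g h

section Transformations

variable {A : Type*} {f g h k : Set (A × A)}

theorem pr1_comp_subset (f g : Set (A × A)) : pr1 (comp g f) ⊆ pr1 f := by
  rintro a ⟨b, c, hc, -⟩
  exact ⟨c, hc⟩

theorem pr1_comp_mono (h : pr1 f ⊆ pr1 g) (k : Set (A × A)) :
    pr1 (comp f k) ⊆ pr1 (comp g k) := by
  rintro a ⟨b, c, hc, hb⟩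
  obtain ⟨d, hd⟩ := h ⟨b, hb⟩
  exact ⟨d, c, hc, hd⟩

theorem comp_subset_comp (h : f ⊆ g) (k : Set (A × A)) : comp k f ⊆ comp k g := by
  rintro p ⟨c, hc, hb⟩
  exact ⟨c, h hc, hb⟩

theorem IsTransformation.inter_comp (hk : IsTransformation k) (f g : Set (A × A)) :
    comp (f ∩ g) k = comp f k ∩ comp g k := by
  ext p
  constructor
  · rintro ⟨b, hb, hf, hg⟩
    exact ⟨⟨b, hb, hf⟩, b, hb, hg⟩
  · rintro ⟨⟨b, hb, hf⟩, c, hc, hg⟩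
    obtain rfl := hk hb hc
    exact ⟨b, hb, hf, hg⟩

theorem IsTransformation.subset_of_pr1_subset_pr1_inter (hf : IsTransformation f)
    (h : pr1 f ⊆ pr1 (f ∩ g)) : f ⊆ g := by
  rintro ⟨a, b⟩ hab
  obtain ⟨c, hc, hg⟩ := h ⟨b, hab⟩
  obtain rfl := hf hab hc
  exact hg

theorem IsTransformation.pr1_subset_pr1_inter_inter (hg : IsTransformation g)
    (h₁ : pr1 f ⊆ pr1 (h ∩ g)) (h₂ : pr1 f ⊆ pr1 (g ∩ k)) : pr1 f ⊆ pr1 (h ∩ g ∩ k) := by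
  intro a ha
  obtain ⟨b, hb, hb'⟩ := h₁ ha
  obtain ⟨c, hc, hc'⟩ := h₂ ha
  obtain rfl := hg hb' hc
  exact ⟨b, ⟨hb, hb'⟩, hc'⟩

theorem IsTransformation.pr1_subset_pr1_comp_inter_inter (hg : IsTransformation g)
    {l : Set (A × A)} (h₁ : pr1 f ⊆ pr1 (h ∩ g)) (h₂ : pr1 f ⊆ pr1 (comp l (g ∩ k))) :
    pr1 f ⊆ pr1 (comp l (h ∩ g ∩ k)) := by
  intro a ha
  obtain ⟨b, hb, hb'⟩ := h₁ ha
  obtain ⟨d, c, ⟨hc, hc'⟩, hd⟩ := h₂ ha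
  obtain rfl := hg hb' hc
  exact ⟨d, b, ⟨⟨hb, hb'⟩, hc'⟩, hd⟩

theorem IsTransformation.pr2_subset_pr1_iff (hf : IsTransformation f) :
    pr2 f ⊆ pr1 g ↔ pr1 f ⊆ pr1 (comp g f) := by
  constructor
  · rintro h a ⟨b, hb⟩
    obtain ⟨c, hc⟩ := h ⟨a, hb⟩
    exact ⟨c, b, hb, hc⟩
  · rintro h b ⟨a, hb⟩
    obtain ⟨c, d, hd, hc⟩ := h ⟨b, hb⟩
    obtain rfl := hf hb hd
    exact ⟨c, hc⟩

end Transformations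

section Representation

variable {G : Type u} (mul meet : G → G → G) (χ : G → G → Prop)

/-- The product `u·g` where the left factor `u` may be omitted. -/
def leftAct (u : Option G) (g : G) : G := u.elim g (mul · g)

/-- The class of `u` under the relation `a ⊏ u ⋏ v`, the omitted factor being alone in its
class. -/
def agreeClass (a : G) (u : Option G) : Option (Set G) :=
  u.map fun x => {y | χ a (meet x y)}

/-- The transformation `[u] ↦ [u·g]`, defined for `a ⊏ u·g`, on the disjoint union over `a` of
the sets of agreement classes. -/
def rightTranslation (g : G) :
    Set ((Option G × Option (Set G)) × (Option G × Option (Set G))) :=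
  {p | ∃ a u, χ a (leftAct mul u g) ∧ p.1 = (some a, agreeClass meet χ a u) ∧
    p.2 = (some a, agreeClass meet χ a (some (leftAct mul u g)))}

/-- The axioms on a semilattice-ordered semigroup with a projection quasi-order. -/
structure IsProjectionSystem : Prop where
  mul_assoc : ∀ a b c, mul (mul a b) c = mul a (mul b c)
  meet_comm : ∀ a b, meet a b = meet b a
  meet_assoc : ∀ a b c, meet (meet a b) c = meet a (meet b c)
  meet_self : ∀ a, meet a a = a
  refl : ∀ a, χ a a
  trans : ∀ a b c, χ a b → χ b c → χ a c
  left_regular : ∀ x a b, χ a b → χ (mul x a) (mul x b)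
  right_negative : ∀ x y z, χ x (mul y z) → χ x y
  of_le : ∀ a b, meet a b = a → χ a b
  mul_meet : ∀ x y z, mul x (meet y z) = meet (mul x y) (mul x z)
  le_of_meet : ∀ x y, χ x (meet x y) → meet x y = x
  meet_mul_le : ∀ x y v, meet (mul (meet x y) v) (mul y v) = mul (meet x y) v
  agree_trans : ∀ x y z v, χ x (meet y z) → χ x (meet z v) → χ x (meet (meet y z) v)
  agree_mul : ∀ x y z v w, χ x (meet y z) → χ x (mul (meet z v) w) →
    χ x (mul (meet (meet y z) v) w)

namespace IsProjectionSystem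

variable {mul meet χ} {a s t g h : G} {u v : Option G}

theorem of_meet_left (S : IsProjectionSystem mul meet χ) (h : χ a (meet s t)) : χ a s :=
  S.trans _ _ _ h <| S.of_le _ _ <| by
    rw [S.meet_comm, ← S.meet_assoc, S.meet_self]

theorem of_meet_right (S : IsProjectionSystem mul meet χ) (h : χ a (meet s t)) : χ a t :=
  S.of_meet_left (S.meet_comm s t ▸ h)

theorem agreeClass_some_eq (S : IsProjectionSystem mul meet χ) (h : χ a (meet s t)) :
    agreeClass meet χ a (some s) = agreeClass meet χ a (some t) := by
  have key : ∀ {s t y}, χ a (meet s t) → χ a (meet s y) → χ a (meet t y) := by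
    intro s t y h₁ h₂
    have := S.agree_trans a t s y (S.meet_comm s t ▸ h₁) h₂
    rw [S.meet_comm t s, S.meet_assoc] at this
    exact S.of_meet_right this
  exact congrArg some (Set.ext fun y => ⟨key h, key (S.meet_comm s t ▸ h)⟩)

theorem meet_of_agreeClass_some_eq (S : IsProjectionSystem mul meet χ) (ht : χ a t)
    (h : agreeClass meet χ a (some s) = agreeClass meet χ a (some t)) : χ a (meet s t) := by
  have hst : {y | χ a (meet s y)} = {y | χ a (meet t y)} := Option.some.inj h
  have : t ∈ {y | χ a (meet t y)} := by simpa [S.meet_self] using ht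
  rwa [← hst] at this

theorem leftAct_agree (S : IsProjectionSystem mul meet χ) (hu : χ a (leftAct mul u g))
    (h : agreeClass meet χ a u = agreeClass meet χ a v) :
    χ a (meet (leftAct mul u g) (leftAct mul v g)) := by
  match u, v with
  | none, none => simpa [S.meet_self] using hu
  | none, some y => exact absurd h (by simp [agreeClass])
  | some x, none => exact absurd h (by simp [agreeClass])
  | some x, some y =>
    have hu : χ a (mul x g) := hu
    have hxy := S.meet_of_agreeClass_some_eq (S.right_negative _ _ _ hu) h.symm
    have := S.agree_mul a y x x g hxy (by rwa [S.meet_self])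
    rw [S.meet_assoc, S.meet_self] at this
    refine S.trans _ _ _ this (S.of_le _ _ ?_)
    change meet _ (meet (mul x g) (mul y g)) = _
    rw [← S.meet_assoc, S.meet_mul_le, S.meet_comm y x, S.meet_mul_le]

theorem leftAct_mul (S : IsProjectionSystem mul meet χ) (u : Option G) (g h : G) :
    leftAct mul u (mul g h) = mul (leftAct mul u g) h := by
  cases u with
  | none => rfl
  | some x => exact (S.mul_assoc x g h).symm

theorem leftAct_meet (S : IsProjectionSystem mul meet χ) (u : Option G) (g h : G) :
    leftAct mul u (meet g h) = meet (leftAct mul u g) (leftAct mul u h) := by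
  cases u with
  | none => rfl
  | some x => exact S.mul_meet x g h

theorem isTransformation_rightTranslation (S : IsProjectionSystem mul meet χ) (g : G) :
    IsTransformation (rightTranslation mul meet χ g) := by
  rintro p q r ⟨a, u, hu, hp, hq⟩ ⟨b, v, -, hp', hr⟩
  dsimp only at hp hq hp' hr
  subst hp hq hr
  obtain ⟨hab, huv⟩ := Prod.mk.inj hp'
  obtain rfl := Option.some.inj hab
  rw [S.agreeClass_some_eq (S.leftAct_agree hu huv)]

theorem rightTranslation_mul (S : IsProjectionSystem mul meet χ) (g h : G) :
    rightTranslation mul meet χ (mul g h) =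
      comp (rightTranslation mul meet χ h) (rightTranslation mul meet χ g) := by
  ext ⟨p, q⟩
  constructor
  · rintro ⟨a, u, hu, hp, hq⟩
    rw [S.leftAct_mul] at hu hq
    exact ⟨(some a, agreeClass meet χ a (some (leftAct mul u g))),
      ⟨a, u, S.right_negative _ _ _ hu, hp, rfl⟩, a, some (leftAct mul u g), hu, rfl, hq⟩
  · rintro ⟨r, ⟨a, u, hu, hp, hr⟩, b, v, hv, hr', hq⟩
    dsimp only at hp hq hr hr'
    subst hr
    obtain ⟨hab, huv⟩ := Prod.mk.inj hr'
    obtain rfl := Option.some.inj hab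
    have key := S.leftAct_agree hv huv.symm
    have hmul := S.leftAct_mul u g h
    refine ⟨a, u, ?_, hp, ?_⟩
    · rw [hmul]
      exact S.of_meet_right key
    · dsimp only
      rw [hmul, hq, S.agreeClass_some_eq key]
      rfl

theorem rightTranslation_meet (S : IsProjectionSystem mul meet χ) (g h : G) :
    rightTranslation mul meet χ (meet g h) =
      rightTranslation mul meet χ g ∩ rightTranslation mul meet χ h := by
  ext ⟨p, q⟩
  constructor
  · rintro ⟨a, u, hu, hp, hq⟩
    rw [S.leftAct_meet] at hu hq
    dsimp only at hp hq
    refine ⟨⟨a, u, S.of_meet_left hu, hp, ?_⟩, a, u, S.of_meet_right hu, hp, ?_⟩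
    · dsimp only
      rw [hq, S.agreeClass_some_eq]
      rwa [S.meet_comm, ← S.meet_assoc, S.meet_self]
    · dsimp only
      rw [hq, S.agreeClass_some_eq]
      rwa [S.meet_assoc, S.meet_self]
  · rintro ⟨⟨a, u, hu, hp, hq⟩, b, v, hv, hp', hq'⟩
    dsimp only at hp hq hp' hq'
    subst hp hq
    obtain ⟨hab, huv⟩ := Prod.mk.inj hp'
    obtain rfl := Option.some.inj hab
    have hcls := (Prod.mk.inj hq').2
    have key := S.leftAct_agree hv huv.symm
    have huh := S.of_meet_right key
    rw [S.agreeClass_some_eq key] at hcls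
    have hmeet := S.meet_of_agreeClass_some_eq huh hcls
    refine ⟨a, u, by rwa [S.leftAct_meet], rfl, ?_⟩
    dsimp only
    rw [S.leftAct_meet, S.agreeClass_some_eq (s := leftAct mul u g)]
    rwa [← S.meet_assoc, S.meet_self]

theorem mem_pr1_rightTranslation_self (S : IsProjectionSystem mul meet χ) (g : G) :
    (some g, none) ∈ pr1 (rightTranslation mul meet χ g) :=
  ⟨_, g, none, S.refl g, rfl, rfl⟩

theorem pr1_rightTranslation_subset_iff (S : IsProjectionSystem mul meet χ) : χ g h ↔
    pr1 (rightTranslation mul meet χ g) ⊆ pr1 (rightTranslation mul meet χ h) := by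
  constructor
  · rintro hgh p ⟨q, a, u, hu, hp, -⟩
    refine ⟨(some a, agreeClass meet χ a (some (leftAct mul u h))), a, u,
      S.trans _ _ _ hu ?_, hp, rfl⟩
    cases u with
    | none => exact hgh
    | some x => exact S.left_regular x g h hgh
  · intro hsub
    obtain ⟨q, a, u, hu, hp, -⟩ := hsub (S.mem_pr1_rightTranslation_self g)
    obtain ⟨hga, hnone⟩ := Prod.mk.inj hp
    obtain rfl := Option.some.inj hga
    cases u with
    | none => exact hu
    | some x => exact absurd hnone (by simp [agreeClass])

theorem rightTranslation_injective (S : IsProjectionSystem mul meet χ) :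
    Function.Injective (rightTranslation mul meet χ) := by
  have key : ∀ g h, rightTranslation mul meet χ g = rightTranslation mul meet χ h →
      meet g h = g := by
    intro g h heq
    apply S.le_of_meet
    rw [S.pr1_rightTranslation_subset_iff, S.rightTranslation_meet, ← heq, Set.inter_self]
  intro g h heq
  rw [← key g h heq, S.meet_comm, key h g heq.symm]

end IsProjectionSystem

end Representation

/-- Abstract characterization of projection ∩-semigroups (Φ,∘,∩,χ_Φ,δ_Φ) of
transformations with the semiadjacency relation δ_Φ = {(f,g) : pr₂ f ⊆ pr₁ g}.
Here x ⊏ y stands for χ x y, x ⊢ y for δ x y and x ≤ y for meet x y = x. -/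
theorem statement_6 {G : Type u} (mul meet : G → G → G) (χ δ : G → G → Prop)
    (hassoc : ∀ a b c, mul (mul a b) c = mul a (mul b c))
    (hcomm : ∀ a b, meet a b = meet b a)
    (hmassoc : ∀ a b c, meet (meet a b) c = meet a (meet b c))
    (hidem : ∀ a, meet a a = a) :
    (∃ (A : Type u) (_ : Nonempty A) (Φ : Set (Set (A × A))),
      (∀ f ∈ Φ, IsTransformation f) ∧
      (∀ f ∈ Φ, ∀ g ∈ Φ, comp g f ∈ Φ) ∧
      (∀ f ∈ Φ, ∀ g ∈ Φ, f ∩ g ∈ Φ) ∧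
      ∃ P : G → Set (A × A),
        (∀ g, P g ∈ Φ) ∧ Function.Injective P ∧ (∀ f ∈ Φ, ∃ g, P g = f) ∧
        (∀ a b, P (mul a b) = comp (P b) (P a)) ∧
        (∀ a b, P (meet a b) = P a ∩ P b) ∧
        (∀ a b, χ a b ↔ pr1 (P a) ⊆ pr1 (P b)) ∧
        (∀ a b, δ a b ↔ pr2 (P a) ⊆ pr1 (P b))) ↔
    ((∀ a, χ a a) ∧
     (∀ a b c, χ a b → χ b c → χ a c) ∧
     (∀ x a b, χ a b → χ (mul x a) (mul x b)) ∧
     (∀ x y z, χ x (mul y z) → χ x y) ∧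
     (∀ a b, meet a b = a → χ a b) ∧
     (∀ x y z, mul x (meet y z) = meet (mul x y) (mul x z)) ∧
     (∀ x y, χ x (meet x y) → meet x y = x) ∧
     (∀ (x y : G) (v : Option G), meet (act mul (meet x y) v) (act mul y v) =
       act mul (meet x y) v) ∧
     (∀ (x y z v : G) (w : Option G), χ x (meet y z) → χ x (act mul (meet z v) w) →
       χ x (act mul (meet (meet y z) v) w)) ∧
     (∀ x y, δ x y ↔ χ x (mul x y))) := by
  constructor
  · rintro ⟨A, -, Φ, hΦ, -, -, P, hPΦ, hinj, -, hmul, hmeet, hχ, hδ⟩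
    have hP : ∀ g, IsTransformation (P g) := fun g => hΦ _ (hPΦ g)
    have le_iff : ∀ a b, meet a b = a ↔ P a ⊆ P b := fun a b => by
      rw [← hinj.eq_iff, hmeet, Set.inter_eq_left]
    refine ⟨fun a => (hχ a a).2 le_rfl, fun a b c hab hbc => ?_, fun x a b hab => ?_,
      fun x y z h => ?_, fun a b h => ?_, fun x y z => hinj ?_, fun x y h => ?_,
      fun x y v => ?_, fun x y z v w h₁ h₂ => ?_, fun x y => ?_⟩
    · rw [hχ] at *
      exact hab.trans hbc
    · rw [hχ] at *
      rw [hmul, hmul]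
      exact pr1_comp_mono hab _
    · rw [hχ] at *
      rw [hmul] at h
      exact h.trans (pr1_comp_subset _ _)
    · rw [hχ]
      rintro p ⟨q, hq⟩
      exact ⟨q, (le_iff a b).1 h hq⟩
    · simp only [hmul, hmeet]
      exact (hP x).inter_comp _ _
    · rw [hχ, hmeet] at h
      exact (le_iff x y).2 ((hP x).subset_of_pr1_subset_pr1_inter h)
    · rw [le_iff]
      cases v with
      | none =>
        change P (meet x y) ⊆ P y
        rw [hmeet]
        exact Set.inter_subset_right
      | some u =>
        change P (mul (meet x y) u) ⊆ P (mul y u)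
        rw [hmul, hmul, hmeet]
        exact comp_subset_comp Set.inter_subset_right _
    · cases w with
      | none =>
        simp only [act, hχ, hmeet] at *
        exact (hP z).pr1_subset_pr1_inter_inter h₁ h₂
      | some u =>
        simp only [act, hχ, hmul, hmeet] at *
        exact (hP z).pr1_subset_pr1_comp_inter_inter h₁ h₂
    · rw [hδ, hχ, hmul]
      exact (hP x).pr2_subset_pr1_iff
  · rintro ⟨hrefl, htrans, hleft, hright, hle, hdist, hmeet, hact, hagree, hδ⟩
    have S : IsProjectionSystem mul meet χ :=
      ⟨hassoc, hcomm, hmassoc, hidem, hrefl, htrans, hleft, hright, hle, hdist, hmeet,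
        fun x y v => hact x y (some v), fun x y z v => hagree x y z v none,
        fun x y z v w => hagree x y z v (some w)⟩
    refine ⟨Option G × Option (Set G), ⟨(none, none)⟩, Set.range (rightTranslation mul meet χ),
      ?_, ?_, ?_, rightTranslation mul meet χ, Set.mem_range_self, S.rightTranslation_injective,
      fun _ hf => hf, S.rightTranslation_mul, S.rightTranslation_meet,
      fun _ _ => S.pr1_rightTranslation_subset_iff, fun a b => ?_⟩
    · rintro _ ⟨g, rfl⟩
      exact S.isTransformation_rightTranslation g
    · rintro _ ⟨g, rfl⟩ _ ⟨h, rfl⟩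
      exact ⟨mul g h, S.rightTranslation_mul g h⟩
    · rintro _ ⟨g, rfl⟩ _ ⟨h, rfl⟩
      exact ⟨meet g h, S.rightTranslation_meet g h⟩
    · rw [hδ, (S.isTransformation_rightTranslation a).pr2_subset_pr1_iff,
        ← S.rightTranslation_mul, S.pr1_rightTranslation_subset_iff]
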